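/- Fix 0 < γ ≤ 1. For all positive integers a, b and all real X ≥ 1, Σ_{n ≤ X} ψ'_{a,b}(n) = Ξ · Ψ'(a,b) · X + O_γ( σ_{−γ/2}(b) · X^γ ), where Ξ = ∏_p φ^×(p)^{−1} (product over all primes p), Ψ'(a,b) = φ*(b) · φ^×(a·b), and the implied constant depends only on γ. -/

import Mathlib

open Real

noncomputable section

/-- `φ*(n) = ∏_{p | n} (1 - 1/p)`. -/
def phiStar (n : ℕ) : ℝ := ∏ p ∈ n.primeFactors, (1 - 1 / (p : ℝ))

/-- `φ⁺(n) = ∏_{p | n} (1 + 1/p)⁻¹`. -/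
def phiPlus (n : ℕ) : ℝ := ∏ p ∈ n.primeFactors, (1 + 1 / (p : ℝ))⁻¹

/-- `φ^×(n) = ∏_{p | n} (1 + 1/p)(1 - 1/p)⁻¹(1 + 2/p - 1/p²)⁻¹`. -/
def phiTimes (n : ℕ) : ℝ :=
  ∏ p ∈ n.primeFactors,
    ((1 + 1 / (p : ℝ)) * (1 - 1 / (p : ℝ))⁻¹ * (1 + 2 / (p : ℝ) - 1 / (p : ℝ) ^ 2)⁻¹)

/-- `ψ'_{a,b}(n)`. -/
def psiab' (a b n : ℕ) : ℝ :=
  if Nat.gcd n b = 1 then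
    phiStar n ^ 2 / phiStar (Nat.gcd a n) ^ 2 * (phiPlus n / phiPlus (Nat.gcd a n))
  else 0

/-- `σ_{-λ}(n) = Σ_{k | n} k^{-λ}`. -/
def sigmaNeg (lam : ℝ) (n : ℕ) : ℝ := ∑ k ∈ n.divisors, (k : ℝ) ^ (-lam)

/-- `Ξ = ∏_p φ^×(p)⁻¹`. -/
def Xi : ℝ := ∏' p : Nat.Primes, (phiTimes (p : ℕ))⁻¹

/-- `Ψ'(a,b) = φ*(b) φ^×(ab)`. -/
def PsiAB' (a b : ℕ) : ℝ := phiStar b * phiTimes (a * b)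

/-- The arithmetic function supported on squarefree `n`, where it equals `∏_{p ∣ n} h p`. -/
def squarefreeProd (h : ℕ → ℝ) : ArithmeticFunction ℝ where
  toFun n := if Squarefree n then ∏ p ∈ n.primeFactors, h p else 0
  map_zero' := by simp

theorem squarefreeProd_apply (h : ℕ → ℝ) (n : ℕ) :
    squarefreeProd h n = if Squarefree n then ∏ p ∈ n.primeFactors, h p else 0 := rfl

theorem squarefreeProd_one (h : ℕ → ℝ) : squarefreeProd h 1 = 1 := by
  simp [squarefreeProd_apply]

theorem squarefreeProd_mul_of_coprime (h : ℕ → ℝ) {m n : ℕ} (hmn : m.Coprime n) :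
    squarefreeProd h (m * n) = squarefreeProd h m * squarefreeProd h n := by
  simp only [squarefreeProd_apply, Nat.squarefree_mul hmn, hmn.primeFactors_mul]
  by_cases hm : Squarefree m <;> by_cases hn : Squarefree n <;>
    simp [hm, hn, Finset.prod_union hmn.disjoint_primeFactors]

theorem squarefreeProd_mul_apply (h k : ℕ → ℝ) (n : ℕ) :
    squarefreeProd h n * squarefreeProd k n = squarefreeProd (fun p ↦ h p * k p) n := by
  simp only [squarefreeProd_apply]
  split_ifs <;> simp [Finset.prod_mul_distrib]

theorem abs_squarefreeProd (h : ℕ → ℝ) (n : ℕ) :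
    |squarefreeProd h n| = squarefreeProd (fun p ↦ |h p|) n := by
  simp only [squarefreeProd_apply]
  split_ifs <;> simp [Finset.abs_prod]

theorem squarefreeProd_rpow (r : ℝ) {n : ℕ} (hn : Squarefree n) :
    squarefreeProd (fun p ↦ (p : ℝ) ^ r) n = (n : ℝ) ^ r := by
  rw [squarefreeProd_apply, if_pos hn, Real.finsetProd_rpow _ _ (fun _ _ ↦ by positivity),
    ← Nat.cast_prod, Nat.prod_primeFactors_of_squarefree hn]

theorem squarefreeProd_mul_rpow (h : ℕ → ℝ) (r : ℝ) (n : ℕ) :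
    squarefreeProd h n * (n : ℝ) ^ r = squarefreeProd (fun p ↦ h p * (p : ℝ) ^ r) n := by
  rw [← squarefreeProd_mul_apply]
  by_cases hn : Squarefree n
  · rw [squarefreeProd_rpow r hn]
  · simp [squarefreeProd_apply, hn]

theorem squarefree_prod_of_primes {s : Finset ℕ} (hs : ∀ p ∈ s, p.Prime) :
    Squarefree (∏ p ∈ s, p) := by
  refine Finset.squarefree_prod_of_pairwise_isCoprime (fun p hp q hq hpq ↦ ?_)
    fun p hp ↦ (hs p hp).squarefree
  exact Nat.coprime_iff_isRelPrime.1 ((Nat.coprime_primes (hs p hp) (hs q hq)).2 hpq)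

theorem sum_squarefreeProd_divisors (h : ℕ → ℝ) {n : ℕ} (hn : n ≠ 0) :
    ∑ d ∈ n.divisors, squarefreeProd h d = ∏ p ∈ n.primeFactors, (1 + h p) := by
  simp only [squarefreeProd_apply]
  rw [← Finset.sum_filter, Finset.prod_one_add]
  have hprime : ∀ s ∈ n.primeFactors.powerset, ∀ p ∈ s, p.Prime := fun s hs p hp ↦
    Nat.prime_of_mem_primeFactors (Finset.mem_powerset.1 hs hp)
  refine Finset.sum_nbij' (fun d ↦ d.primeFactors) (fun s ↦ ∏ p ∈ s, p) ?_ ?_ ?_ ?_ ?_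
  · intro d hd
    simp only [Finset.mem_filter, Nat.mem_divisors] at hd
    exact Finset.mem_powerset.2 (Nat.primeFactors_mono hd.1.1 hn)
  · intro s hs
    simp only [Finset.mem_filter, Nat.mem_divisors]
    refine ⟨⟨?_, hn⟩, squarefree_prod_of_primes (hprime s hs)⟩
    exact (Finset.prod_dvd_prod_of_subset _ _ _ (Finset.mem_powerset.1 hs)).trans
      (Nat.prod_primeFactors_dvd n)
  · intro d hd
    exact Nat.prod_primeFactors_of_squarefree (Finset.mem_filter.1 hd).2
  · intro s hs
    exact Nat.primeFactors_prod (hprime s hs)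
  · intro d hd
    rfl

theorem sum_Icc_prod_one_add (h : ℕ → ℝ) (N : ℕ) :
    ∑ n ∈ Finset.Icc 1 N, ∏ p ∈ n.primeFactors, (1 + h p) =
      ∑ d ∈ Finset.Icc 1 N, squarefreeProd h d * ((N / d : ℕ) : ℝ) := by
  have := ArithmeticFunction.sum_Ioc_mul_zeta_eq_sum (squarefreeProd h) N
  simp only [ArithmeticFunction.coe_mul_zeta_apply] at this
  change ∑ n ∈ Finset.Ioc 0 N, _ = ∑ n ∈ Finset.Ioc 0 N, _
  rw [← this]
  refine Finset.sum_congr rfl fun n hn ↦ ?_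
  exact (sum_squarefreeProd_divisors h (by simp at hn; lia)).symm

theorem abs_floor_sub_le_rpow {y γ : ℝ} (hy : 0 ≤ y) (hγ : 0 < γ) (hγ1 : γ ≤ 1) :
    |(⌊y⌋₊ : ℝ) - y| ≤ y ^ γ := by
  rcases lt_or_ge y 1 with h | h
  · rw [Nat.floor_eq_zero.2 h]
    rcases hy.eq_or_lt with rfl | hy
    · simp [hγ.ne']
    · simpa [abs_of_pos hy] using Real.rpow_le_rpow_of_exponent_ge hy h.le hγ1
  · have h1 := Nat.floor_le hy
    have h2 := Nat.lt_floor_add_one y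
    have h3 := Real.one_le_rpow h hγ.le
    rw [abs_le]
    constructor <;> linarith

theorem abs_sum_prod_one_add_sub_le {h : ℕ → ℝ} {γ X : ℝ} (hγ : 0 < γ) (hγ1 : γ ≤ 1)
    (hX : 0 ≤ X) (hs : Summable fun d : ℕ ↦ |squarefreeProd h d| * (d : ℝ) ^ (-γ)) :
    |∑ n ∈ Finset.Icc 1 ⌊X⌋₊, ∏ p ∈ n.primeFactors, (1 + h p) -
        (∑' d : ℕ, squarefreeProd h d * (d : ℝ) ^ (-1 : ℝ)) * X| ≤
      (∑' d : ℕ, |squarefreeProd h d| * (d : ℝ) ^ (-γ)) * X ^ γ := by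
  have hs1 : Summable fun d : ℕ ↦ squarefreeProd h d * (d : ℝ) ^ (-1 : ℝ) := by
    refine hs.of_norm_bounded fun d ↦ ?_
    rcases d.eq_zero_or_pos with rfl | hd
    · simp
    · rw [Real.norm_eq_abs, abs_mul, abs_of_nonneg (by positivity : (0 : ℝ) ≤ (d : ℝ) ^ (-1 : ℝ))]
      gcongr
      exact_mod_cast hd
  have hsum : HasSum (fun d : ℕ ↦ squarefreeProd h d * (⌊X / d⌋₊ : ℝ))
      (∑ n ∈ Finset.Icc 1 ⌊X⌋₊, ∏ p ∈ n.primeFactors, (1 + h p)) := by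
    rw [sum_Icc_prod_one_add]
    simp only [← Nat.floor_div_natCast]
    refine hasSum_sum_of_ne_finset_zero fun d hd ↦ ?_
    rcases d.eq_zero_or_pos with rfl | hd0
    · simp
    · have : ⌊X⌋₊ < d := by simp at hd; lia
      simp [Nat.floor_div_natCast, Nat.div_eq_of_lt this]
  have hdiff := hsum.sub (hs1.hasSum.mul_right X)
  rw [← hdiff.tsum_eq, ← tsum_mul_right, ← Real.norm_eq_abs]
  refine tsum_of_norm_bounded (hs.mul_right _).hasSum fun d ↦ ?_
  have := abs_floor_sub_le_rpow (y := X / d) (by positivity) hγ hγ1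
  rw [Real.div_rpow hX (by positivity), div_eq_mul_inv (X ^ γ),
    ← Real.rpow_neg (by positivity)] at this
  calc ‖squarefreeProd h d * (⌊X / d⌋₊ : ℝ) - squarefreeProd h d * (d : ℝ) ^ (-1 : ℝ) * X‖
      = |squarefreeProd h d| * |(⌊X / d⌋₊ : ℝ) - X / d| := by
        rw [Real.norm_eq_abs, ← abs_mul, Real.rpow_neg_one]
        congr 1
        ring
    _ ≤ |squarefreeProd h d| * (X ^ γ * (d : ℝ) ^ (-γ)) := by gcongr
    _ = _ := by ring

theorem sum_squarefreeProd_le_prod {h : ℕ → ℝ} (hh : ∀ p, 0 ≤ h p) {T s : Finset ℕ}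
    (hT : ∀ d ∈ T, d.primeFactors ⊆ s) :
    ∑ d ∈ T, squarefreeProd h d ≤ ∏ p ∈ s, (1 + h p) := by
  simp only [squarefreeProd_apply]
  rw [← Finset.sum_filter, Finset.prod_one_add]
  rw [← Finset.sum_image (s := T.filter Squarefree) (g := fun d : ℕ ↦ d.primeFactors)
    (f := fun t ↦ ∏ p ∈ t, h p)]
  · refine Finset.sum_le_sum_of_subset_of_nonneg ?_ fun _ _ _ ↦ Finset.prod_nonneg fun _ _ ↦ hh _
    intro t ht
    obtain ⟨d, hd, rfl⟩ := Finset.mem_image.1 ht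
    exact Finset.mem_powerset.2 (hT d (Finset.mem_filter.1 hd).1)
  · intro d hd e he hde
    simp only [Finset.coe_filter, Set.mem_ofPred_eq] at hd he
    rw [← Nat.prod_primeFactors_of_squarefree hd.2, ← Nat.prod_primeFactors_of_squarefree he.2]
    exact congrArg (fun t ↦ ∏ p ∈ t, p) hde

theorem prod_one_add_rpow_le_sigmaNeg (lam : ℝ) {b : ℕ} (hb : b ≠ 0) :
    ∏ p ∈ b.primeFactors, (1 + (p : ℝ) ^ (-lam)) ≤ sigmaNeg lam b := by
  rw [← sum_squarefreeProd_divisors _ hb]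
  refine Finset.sum_le_sum fun d _ ↦ ?_
  by_cases hd : Squarefree d
  · rw [squarefreeProd_rpow _ hd]
  · rw [squarefreeProd_apply, if_neg hd]
    positivity

theorem sigmaNeg_le_sigmaNeg {l m : ℝ} (hlm : l ≤ m) (b : ℕ) : sigmaNeg m b ≤ sigmaNeg l b := by
  refine Finset.sum_le_sum fun d hd ↦ ?_
  have : (1 : ℝ) ≤ d := by exact_mod_cast Nat.pos_of_mem_divisors hd
  gcongr

theorem sum_abs_squarefreeProd_mul_rpow_le {h : ℕ → ℝ} {b : ℕ} {γ c : ℝ} (hγ : 0 < γ)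
    (hb : b ≠ 0) (hc : 0 ≤ c) (h1 : ∀ p : ℕ, p.Prime → p ∣ b → |h p| ≤ 1)
    (h2 : ∀ p : ℕ, p.Prime → ¬p ∣ b → |h p| ≤ c / p) (T : Finset ℕ) :
    ∑ d ∈ T, |squarefreeProd h d| * (d : ℝ) ^ (-γ) ≤
      Real.exp (∑' n : ℕ, c * (n : ℝ) ^ (-(1 + γ))) * sigmaNeg γ b := by
  have hsum : Summable fun n : ℕ ↦ c * (n : ℝ) ^ (-(1 + γ)) :=
    (Real.summable_nat_rpow.2 (by linarith)).mul_left c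
  set s := T.biUnion (fun d ↦ d.primeFactors) ∪ b.primeFactors with hs
  have hsp : ∀ p ∈ s, p.Prime := by
    intro p hp
    simp only [hs, Finset.mem_union, Finset.mem_biUnion] at hp
    rcases hp with ⟨d, -, hd⟩ | hd <;> exact Nat.prime_of_mem_primeFactors hd
  have hfilter : s.filter (· ∣ b) = b.primeFactors := by
    ext p
    simp only [Finset.mem_filter]
    refine ⟨fun hp ↦ (hsp p hp.1).mem_primeFactors hp.2 hb, fun hp ↦ ⟨?_, ?_⟩⟩
    · exact Finset.mem_union_right _ hp
    · exact Nat.dvd_of_mem_primeFactors hp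
  simp only [abs_squarefreeProd, squarefreeProd_mul_rpow]
  refine (sum_squarefreeProd_le_prod (fun p ↦ by positivity) (s := s) fun d hd ↦ ?_).trans ?_
  · exact (Finset.subset_biUnion_of_mem (fun d : ℕ ↦ d.primeFactors) hd).trans
      Finset.subset_union_left
  calc ∏ p ∈ s, (1 + |h p| * (p : ℝ) ^ (-γ))
      ≤ ∏ p ∈ s, (Real.exp (c * (p : ℝ) ^ (-(1 + γ))) *
          if p ∣ b then 1 + (p : ℝ) ^ (-γ) else 1) := by
        refine Finset.prod_le_prod (fun p _ ↦ by positivity) fun p hp ↦ ?_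
        have hp0 : (0 : ℝ) < p := by exact_mod_cast (hsp p hp).pos
        split_ifs with hpb
        · calc 1 + |h p| * (p : ℝ) ^ (-γ) ≤ 1 * (1 + 1 * (p : ℝ) ^ (-γ)) := by
                rw [one_mul]
                gcongr
                exact h1 p (hsp p hp) hpb
            _ ≤ _ := by
                rw [one_mul ((p : ℝ) ^ (-γ))]
                gcongr
                exact Real.one_le_exp (by positivity)
        · rw [mul_one]
          refine le_trans ?_ (Real.add_one_le_exp _)
          rw [add_comm, neg_add, Real.rpow_add hp0, Real.rpow_neg_one, ← mul_assoc,
            ← div_eq_mul_inv]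
          gcongr
          exact h2 p (hsp p hp) hpb
    _ = Real.exp (∑ p ∈ s, c * (p : ℝ) ^ (-(1 + γ))) *
          ∏ p ∈ b.primeFactors, (1 + (p : ℝ) ^ (-γ)) := by
        rw [Finset.prod_mul_distrib, Real.exp_sum, ← Finset.prod_filter, hfilter]
    _ ≤ _ := by
        gcongr
        · exact hsum.sum_le_tsum s fun n _ ↦ by positivity
        · exact prod_one_add_rpow_le_sigmaNeg γ hb

theorem HasProd.of_forall_eq {ι : Type*} {f g : ι → ℝ} {x : ℝ} (hf : HasProd f x)
    (hfg : ∀ i, f i = g i) : HasProd g x :=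
  funext hfg ▸ hf

theorem hasProd_one_add_mul_rpow {h : ℕ → ℝ} (r : ℝ)
    (hs : Summable fun d : ℕ ↦ |squarefreeProd h d| * (d : ℝ) ^ r) :
    HasProd (fun p : Nat.Primes ↦ 1 + h p * ((p : ℕ) : ℝ) ^ r)
      (∑' d : ℕ, squarefreeProd h d * (d : ℝ) ^ r) := by
  simp only [squarefreeProd_mul_rpow]
  have key := EulerProduct.eulerProduct_hasProd
    (f := fun n ↦ squarefreeProd (fun p ↦ h p * (p : ℝ) ^ r) n) (squarefreeProd_one _)
    (squarefreeProd_mul_of_coprime _) ?_ (by simp)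
  · refine key.of_forall_eq fun p ↦ ?_
    rw [tsum_eq_sum (s := {0, 1})]
    · simp [squarefreeProd_apply, p.2.primeFactors, p.2.squarefree]
    · intro e he
      simp only [Finset.mem_insert, Finset.mem_singleton, not_or] at he
      rw [squarefreeProd_apply, if_neg]
      rw [Nat.squarefree_pow_iff p.2.ne_one he.1]
      exact fun h ↦ he.2 h.2
  · refine hs.congr fun d ↦ ?_
    rw [← squarefreeProd_mul_rpow, norm_mul, Real.norm_eq_abs, Real.norm_of_nonneg (by positivity)]

/-- The value at a prime `p` of the Möbius transform of `psiab' a b`. -/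
def psiWeight (a b p : ℕ) : ℝ :=
  if p ∣ b then -1 else if p ∣ a then 0 else (1 - 1 / (p : ℝ)) ^ 2 * (1 + 1 / (p : ℝ))⁻¹ - 1

theorem psiab'_eq_prod {a n : ℕ} (b : ℕ) (ha : a ≠ 0) (hn : n ≠ 0) :
    psiab' a b n = ∏ p ∈ n.primeFactors, (1 + psiWeight a b p) := by
  unfold psiab'
  split_ifs with hnb
  · have hb : ∀ p ∈ n.primeFactors, ¬p ∣ b := fun p hp hpb ↦
      (Nat.prime_of_mem_primeFactors hp).not_dvd_one
        (hnb ▸ Nat.dvd_gcd (Nat.dvd_of_mem_primeFactors hp) hpb)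
    have hfilter : (a.gcd n).primeFactors = n.primeFactors.filter (· ∣ a) := by
      ext p
      simp only [Nat.primeFactors_gcd ha hn, Finset.mem_inter, Finset.mem_filter,
        Nat.mem_primeFactors]
      tauto
    have hdiv : ∀ f : ℕ → ℝ, (∀ p ∈ n.primeFactors, f p ≠ 0) →
        (∏ p ∈ n.primeFactors, f p) / (∏ p ∈ (a.gcd n).primeFactors, f p) =
          ∏ p ∈ n.primeFactors, if p ∣ a then 1 else f p := by
      intro f hf
      rw [hfilter, Finset.prod_filter, ← Finset.prod_div_distrib]
      refine Finset.prod_congr rfl fun p hp ↦ ?_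
      split_ifs <;> simp [hf p hp]
    rw [← div_pow, phiStar, phiStar, phiPlus, phiPlus, hdiv, hdiv, ← Finset.prod_pow,
      ← Finset.prod_mul_distrib]
    · refine Finset.prod_congr rfl fun p hp ↦ ?_
      rw [psiWeight, if_neg (hb p hp)]
      split_ifs <;> ring
    · intro p hp
      positivity
    · intro p hp
      have : (1 : ℝ) < p := by exact_mod_cast (Nat.prime_of_mem_primeFactors hp).one_lt
      rw [sub_ne_zero]
      exact (div_lt_one (by linarith)).2 this |>.ne'
  · obtain ⟨p, hp, hpd⟩ := Nat.exists_prime_and_dvd hnb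
    refine (Finset.prod_eq_zero
      (hp.mem_primeFactors (hpd.trans (Nat.gcd_dvd_left _ _)) hn) ?_).symm
    simp [psiWeight, hpd.trans (Nat.gcd_dvd_right _ _)]

theorem abs_psiWeight_le_one {a b p : ℕ} (hpb : p ∣ b) : |psiWeight a b p| ≤ 1 := by
  simp [psiWeight, hpb]

theorem abs_psiWeight_le {a b p : ℕ} (hp : p.Prime) (hpb : ¬p ∣ b) :
    |psiWeight a b p| ≤ 3 / p := by
  have hp1 : (1 : ℝ) < p := by exact_mod_cast hp.one_lt
  have hp0 : (0 : ℝ) < p := by linarith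
  rw [psiWeight, if_neg hpb]
  split_ifs with hpa
  · simp only [abs_zero]
    positivity
  · have : (1 - 1 / (p : ℝ)) ^ 2 * (1 + 1 / (p : ℝ))⁻¹ - 1 = -((3 * p - 1) / (p * (p + 1))) := by
      field_simp
      ring
    rw [this, abs_neg, abs_of_nonneg (by apply div_nonneg <;> nlinarith),
      div_le_div_iff₀ (by positivity) hp0]
    nlinarith

theorem phiTimes_prime {p : ℕ} (hp : p.Prime) :
    phiTimes p = (1 + 1 / (p : ℝ)) * (1 - 1 / (p : ℝ))⁻¹ *
      (1 + 2 / (p : ℝ) - 1 / (p : ℝ) ^ 2)⁻¹ := by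
  simp [phiTimes, hp.primeFactors]

theorem one_add_psiWeight_mul_rpow {a b p : ℕ} (hp : p.Prime) (hpa : ¬p ∣ a) (hpb : ¬p ∣ b) :
    1 + psiWeight a b p * (p : ℝ) ^ (-1 : ℝ) = (phiTimes p)⁻¹ := by
  have hp1 : (1 : ℝ) < p := by exact_mod_cast hp.one_lt
  have hp0 : (0 : ℝ) < p := by linarith
  have h1 : (p : ℝ) - 1 ≠ 0 := by linarith
  have h2 : (p : ℝ) ^ 2 + 2 * p - 1 ≠ 0 := by nlinarith
  rw [phiTimes_prime hp, psiWeight, if_neg hpb, if_neg hpa, Real.rpow_neg_one, mul_inv, mul_inv,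
    inv_inv, inv_inv]
  field_simp
  ring

theorem phiTimes_prime_ne_zero {p : ℕ} (hp : p.Prime) : phiTimes p ≠ 0 := by
  have hp1 : (1 : ℝ) < p := by exact_mod_cast hp.one_lt
  have h1 : 1 / (p : ℝ) < 1 := (div_lt_one (by linarith)).2 hp1
  have h0 : 0 < 1 / (p : ℝ) := by positivity
  have h2 : 0 < 1 + 2 / (p : ℝ) - 1 / (p : ℝ) ^ 2 := by
    have e : 1 + 2 / (p : ℝ) - 1 / (p : ℝ) ^ 2 = 1 + 2 * (1 / (p : ℝ)) - (1 / (p : ℝ)) ^ 2 := by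
      ring
    rw [e]
    nlinarith
  rw [phiTimes_prime hp]
  have h3 : 0 < 1 - 1 / (p : ℝ) := by linarith
  positivity

theorem hasProd_PsiAB' {a b : ℕ} (ha : a ≠ 0) (hb : b ≠ 0) :
    HasProd (fun p : Nat.Primes ↦ if (p : ℕ) ∣ a * b then
      phiTimes p * if (p : ℕ) ∣ b then 1 - 1 / ((p : ℕ) : ℝ) else 1 else 1) (PsiAB' a b) := by
  have hab := mul_ne_zero ha hb
  have key := hasProd_prod_of_ne_finset_one (L := .unconditional ℕ) (s := (a * b).primeFactors)
    (f := Set.mulIndicator {p : ℕ | p.Prime} fun p ↦ if p ∣ a * b then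
      phiTimes p * if p ∣ b then 1 - 1 / (p : ℝ) else 1 else 1) fun p hp ↦ by
        by_cases h : p.Prime
        · have : ¬p ∣ a * b := fun hd ↦ hp (h.mem_primeFactors hd hab)
          simp [this]
        · simp [h]
  rw [← hasProd_subtype_iff_mulIndicator] at key
  convert! key using 1
  have hfilter : (a * b).primeFactors.filter (· ∣ b) = b.primeFactors := by
    ext p
    simp only [Finset.mem_filter, Nat.mem_primeFactors]
    exact ⟨fun h ↦ ⟨h.1.1, h.2, hb⟩, fun h ↦ ⟨⟨h.1, h.2.1.mul_left a, hab⟩, h.2.1⟩⟩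
  rw [PsiAB', mul_comm, phiStar, ← hfilter, Finset.prod_filter, phiTimes,
    ← Finset.prod_mul_distrib]
  refine Finset.prod_congr rfl fun p hp ↦ ?_
  have hpp := Nat.prime_of_mem_primeFactors hp
  simp [hpp, Nat.dvd_of_mem_primeFactors hp, phiTimes_prime hpp]

theorem tsum_squarefreeProd_psiWeight {a b : ℕ} (ha : a ≠ 0) (hb : b ≠ 0)
    (hs : ∀ a b : ℕ, b ≠ 0 →
      Summable fun d : ℕ ↦ |squarefreeProd (psiWeight a b) d| * (d : ℝ) ^ (-1 : ℝ)) :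
    ∑' d : ℕ, squarefreeProd (psiWeight a b) d * (d : ℝ) ^ (-1 : ℝ) = Xi * PsiAB' a b := by
  have hXi : HasProd (fun p : Nat.Primes ↦ (phiTimes (p : ℕ))⁻¹) Xi := by
    refine Multipliable.hasProd ?_
    refine ((hasProd_one_add_mul_rpow _ (hs 1 1 one_ne_zero)).of_forall_eq
      fun p ↦ ?_).multipliable
    exact one_add_psiWeight_mul_rpow p.2 p.2.not_dvd_one p.2.not_dvd_one
  refine (hasProd_one_add_mul_rpow _ (hs a b hb)).unique
    ((hXi.mul (hasProd_PsiAB' ha hb)).of_forall_eq fun p ↦ ?_)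
  have h0 := phiTimes_prime_ne_zero p.2
  by_cases hpb : (p : ℕ) ∣ b
  · simp only [hpb, hpb.mul_left a, if_true, psiWeight, inv_mul_cancel_left₀ h0,
      Real.rpow_neg_one]
    ring
  by_cases hpa : (p : ℕ) ∣ a
  · simp [hpb, hpa.mul_right b, hpa, psiWeight, h0]
  · rw [if_neg (by simp [p.2.dvd_mul, hpa, hpb]), mul_one, one_add_psiWeight_mul_rpow p.2 hpa hpb]

/-- Average of `ψ'_{a,b}` up to `X`. -/
theorem sum_psiab' :
    ∀ γ : ℝ, 0 < γ → γ ≤ 1 → ∃ C : ℝ, ∀ (a b : ℕ) (X : ℝ),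
      0 < a → 0 < b → 1 ≤ X →
      |∑ n ∈ Finset.Icc 1 ⌊X⌋₊, psiab' a b n - Xi * PsiAB' a b * X| ≤
        C * sigmaNeg (γ / 2) b * X ^ γ := by
  intro γ hγ hγ1
  have hbound : ∀ (a b : ℕ), b ≠ 0 → ∀ r : ℝ, 0 < r → ∀ T : Finset ℕ,
      ∑ d ∈ T, |squarefreeProd (psiWeight a b) d| * (d : ℝ) ^ (-r) ≤
        Real.exp (∑' n : ℕ, 3 * (n : ℝ) ^ (-(1 + r))) * sigmaNeg r b := fun a b hb r hr ↦
    sum_abs_squarefreeProd_mul_rpow_le hr hb (by norm_num)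
      (fun _ _ ↦ abs_psiWeight_le_one) (fun _ ↦ abs_psiWeight_le)
  have hsummable : ∀ (a b : ℕ), b ≠ 0 → ∀ r : ℝ, 0 < r →
      Summable fun d : ℕ ↦ |squarefreeProd (psiWeight a b) d| * (d : ℝ) ^ (-r) :=
    fun a b hb r hr ↦ summable_of_sum_le (fun _ ↦ by positivity) (hbound a b hb r hr)
  refine ⟨Real.exp (∑' n : ℕ, 3 * (n : ℝ) ^ (-(1 + γ))), fun a b X ha hb hX ↦ ?_⟩
  have hmain := abs_sum_prod_one_add_sub_le hγ hγ1 (zero_le_one.trans hX)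
    (hsummable a b hb.ne' γ hγ)
  rw [tsum_squarefreeProd_psiWeight ha.ne' hb.ne'
      (fun a b hb ↦ hsummable a b hb 1 one_pos),
    ← Finset.sum_congr rfl fun n hn ↦
      psiab'_eq_prod b ha.ne' (Nat.one_le_iff_ne_zero.1 (Finset.mem_Icc.1 hn).1)] at hmain
  refine hmain.trans ?_
  gcongr
  refine ((hsummable a b hb.ne' γ hγ).tsum_le_of_sum_le (hbound a b hb.ne' γ hγ)).trans ?_
  gcongr
  exact sigmaNeg_le_sigmaNeg (by linarith) b

end
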